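/- Let q_tx, q_rc : [0, ∞) → [0, ∞) be continuous, strictly increasing bijections with q_tx(0) = q_rc(0) = 0, let b̄_tx > 0, b̄_rc > 0 satisfy q_tx⁻¹(b̄_tx) ≤ q_rc⁻¹(b̄_rc), and let (B_k_tx)_{k≥1}, (B_k_rc)_{k≥1} be nonnegative sequences with (1/K) Σ_{k=1}^K B_k_tx → b̄_tx and (1/K) Σ_{k=1}^K B_k_rc → b̄_rc as K → ∞. Then for every ε ∈ (0, b̄_tx) there exists an integer N ≥ 1 such that the sequence P_k = 0 for k ≤ N and P_k = q_tx⁻¹(b̄_tx − ε) for k > N is feasible, i.e. Σ_{j=1}^k q_tx(P_j) ≤ Σ_{j=1}^{k−1} B_j_tx and Σ_{j=1}^k q_rc(P_j) ≤ Σ_{j=1}^{k−1} B_j_rc for all k ≥ 1. Consequently, for every nondecreasing g : [0, ∞) → ℝ and every ε ∈ (0, b̄_tx), there is a feasible power sequence whose liminf average reward liminf_{K→∞} (1/K) Σ_{k=1}^K g(P_k) is at least g(q_tx⁻¹(b̄_tx − ε)). -/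

import Mathlib

open Filter Finset

lemma sum_Icc_one_ite_le_eq (N : ℕ) (c : ℝ) (k : ℕ) :
    ∑ j ∈ Finset.Icc 1 k, (if j ≤ N then 0 else c) = ((k - N : ℕ) : ℝ) * c := by
  induction k with
  | zero => simp
  | succ k ih =>
    rw [Finset.sum_Icc_succ_top (by omega), ih]
    split_ifs with h
    · simp [Nat.sub_eq_zero_of_le h, Nat.sub_eq_zero_of_le (Nat.le_of_succ_le h)]
    · rw [Nat.succ_sub (by omega : N ≤ k)]
      push_cast
      ring

/-- A consumption rate strictly below the mean arrival rate, started after a long enough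
silent phase, respects the energy causality constraint. -/
lemma eventually_sum_ite_le_sum_of_lt_mean {B : ℕ → ℝ} (hB : ∀ k, 0 ≤ B k) {b c : ℝ}
    (hc : 0 ≤ c) (hcb : c < b)
    (hmean : Tendsto (fun K => (∑ k ∈ Finset.Icc 1 K, B k) / (K : ℝ)) atTop (nhds b)) :
    ∀ᶠ N : ℕ in atTop, ∀ k : ℕ,
      ∑ j ∈ Finset.Icc 1 k, (if j ≤ N then 0 else c) ≤ ∑ j ∈ Finset.Icc 1 (k - 1), B j := by
  obtain ⟨M, hM⟩ := eventually_atTop.1 (hmean.eventually_const_lt hcb)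
  filter_upwards [eventually_ge_atTop M, eventually_ge_atTop 1] with N hMN hN k
  rw [sum_Icc_one_ite_le_eq]
  rcases le_or_gt k N with hk | hk
  · rw [Nat.sub_eq_zero_of_le hk]
    simpa using Finset.sum_nonneg fun j _ => hB j
  · have hpos : (0 : ℝ) < ((k - 1 : ℕ) : ℝ) := by
      exact_mod_cast (by omega : 0 < k - 1)
    have hle : ((k - N : ℕ) : ℝ) ≤ ((k - 1 : ℕ) : ℝ) := by
      exact_mod_cast (by omega : k - N ≤ k - 1)
    have hlt := (lt_div_iff₀ hpos).1 (hM (k - 1) (by omega))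
    nlinarith [mul_le_mul_of_nonneg_right hle hc]

lemma tendsto_average_Icc_one {u : ℕ → ℝ} {l : ℝ} (hu : Tendsto u atTop (nhds l)) :
    Tendsto (fun K : ℕ => (∑ k ∈ Finset.Icc 1 K, u k) / (K : ℝ)) atTop (nhds l) := by
  have hsum : ∀ K : ℕ, ∑ k ∈ Finset.Icc 1 K, u k = ∑ k ∈ Finset.range K, u (k + 1) := by
    intro K
    induction K with
    | zero => simp
    | succ K ih => rw [Finset.sum_Icc_succ_top (by omega), ih, Finset.sum_range_succ]
  refine ((hu.comp (tendsto_add_atTop_nat 1)).cesaro).congr fun K => ?_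
  rw [hsum, div_eq_inv_mul]
  rfl

/-- Save-and-transmit achievability with infinite batteries and no energy
transfer (Corollary 2 of the paper): for every `ε ∈ (0, b̄tx)` the policy
that stays silent for the first `N` slots and then transmits at the constant
power `qtx⁻¹(b̄tx − ε)` is feasible for some `N`, and hence a liminf average
reward of at least `g (qtx⁻¹(b̄tx − ε))` is achievable. -/
theorem save_and_transmit_no_ET
    (qtx qrc qtxinv qrcinv : ℝ → ℝ)
    -- qtx is a continuous strictly increasing bijection of [0,∞) with qtx 0 = 0
    (hqtx_cont : ContinuousOn qtx (Set.Ici 0))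
    (hqtx_mono : StrictMonoOn qtx (Set.Ici 0))
    (hqtx_maps : Set.MapsTo qtx (Set.Ici 0) (Set.Ici 0))
    (hqtx_surj : Set.SurjOn qtx (Set.Ici 0) (Set.Ici 0))
    (hqtx0 : qtx 0 = 0)
    (hqtxinv_left : ∀ x ∈ Set.Ici (0:ℝ), qtxinv (qtx x) = x)
    (hqtxinv_right : ∀ y ∈ Set.Ici (0:ℝ), qtx (qtxinv y) = y)
    -- qrc is a continuous strictly increasing bijection of [0,∞) with qrc 0 = 0
    (hqrc_cont : ContinuousOn qrc (Set.Ici 0))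
    (hqrc_mono : StrictMonoOn qrc (Set.Ici 0))
    (hqrc_maps : Set.MapsTo qrc (Set.Ici 0) (Set.Ici 0))
    (hqrc_surj : Set.SurjOn qrc (Set.Ici 0) (Set.Ici 0))
    (hqrc0 : qrc 0 = 0)
    (hqrcinv_left : ∀ x ∈ Set.Ici (0:ℝ), qrcinv (qrc x) = x)
    (hqrcinv_right : ∀ y ∈ Set.Ici (0:ℝ), qrc (qrcinv y) = y)
    -- average arrivals, with the transmitter as the bottleneck
    (bbartx bbarrc : ℝ) (hbtx : 0 < bbartx) (hbrc : 0 < bbarrc)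
    (hbottleneck : qtxinv bbartx ≤ qrcinv bbarrc)
    -- the energy arrival sequences and their Cesàro means
    (Btx Brc : ℕ → ℝ)
    (hBtx_nonneg : ∀ k, 0 ≤ Btx k) (hBrc_nonneg : ∀ k, 0 ≤ Brc k)
    (hBtx_mean :
      Tendsto (fun K => (∑ k ∈ Finset.Icc 1 K, Btx k) / (K : ℝ)) atTop (nhds bbartx))
    (hBrc_mean :
      Tendsto (fun K => (∑ k ∈ Finset.Icc 1 K, Brc k) / (K : ℝ)) atTop (nhds bbarrc)) :
    (∀ ε ∈ Set.Ioo (0:ℝ) bbartx, ∃ N : ℕ, 1 ≤ N ∧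
      ∀ k : ℕ, 1 ≤ k →
        (∑ j ∈ Finset.Icc 1 k, qtx (if j ≤ N then 0 else qtxinv (bbartx - ε)))
          ≤ ∑ j ∈ Finset.Icc 1 (k - 1), Btx j ∧
        (∑ j ∈ Finset.Icc 1 k, qrc (if j ≤ N then 0 else qtxinv (bbartx - ε)))
          ≤ ∑ j ∈ Finset.Icc 1 (k - 1), Brc j) ∧
    (∀ g : ℝ → ℝ, (∀ x y : ℝ, 0 ≤ x → x ≤ y → g x ≤ g y) →
      ∀ ε ∈ Set.Ioo (0:ℝ) bbartx,
        ∃ P : ℕ → ℝ, (∀ k, 0 ≤ P k) ∧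
          (∀ k : ℕ, 1 ≤ k →
            (∑ j ∈ Finset.Icc 1 k, qtx (P j)) ≤ ∑ j ∈ Finset.Icc 1 (k - 1), Btx j ∧
            (∑ j ∈ Finset.Icc 1 k, qrc (P j)) ≤ ∑ j ∈ Finset.Icc 1 (k - 1), Brc j) ∧
          g (qtxinv (bbartx - ε))
            ≤ liminf (fun K => (∑ k ∈ Finset.Icc 1 K, g (P k)) / (K : ℝ)) atTop) := by
  have hinv_nonneg : ∀ y, 0 ≤ y → 0 ≤ qtxinv y := by
    intro y hy
    obtain ⟨x, hx, rfl⟩ := hqtx_surj hy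
    rw [hqtxinv_left x hx]
    exact hx
  have hfeasible : ∀ ε ∈ Set.Ioo (0:ℝ) bbartx, ∃ N : ℕ, 1 ≤ N ∧
      ∀ k : ℕ, 1 ≤ k →
        (∑ j ∈ Finset.Icc 1 k, qtx (if j ≤ N then 0 else qtxinv (bbartx - ε)))
          ≤ ∑ j ∈ Finset.Icc 1 (k - 1), Btx j ∧
        (∑ j ∈ Finset.Icc 1 k, qrc (if j ≤ N then 0 else qtxinv (bbartx - ε)))
          ≤ ∑ j ∈ Finset.Icc 1 (k - 1), Brc j := by
    rintro ε ⟨hε, hεb⟩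
    have hp := hinv_nonneg (bbartx - ε) (by linarith)
    have hb := hinv_nonneg bbartx hbtx.le
    have hqtx_eq : qtx (qtxinv (bbartx - ε)) = bbartx - ε :=
      hqtxinv_right _ (Set.mem_Ici.2 (by linarith))
    have hp_lt : qtxinv (bbartx - ε) < qtxinv bbartx := by
      rw [← hqtx_mono.lt_iff_lt hp hb, hqtx_eq, hqtxinv_right _ hbtx.le]
      linarith
    have hqrc_lt : qrc (qtxinv (bbartx - ε)) < bbarrc := by
      rw [← hqrcinv_right bbarrc hbrc.le]
      exact hqrc_mono hp (hb.trans hbottleneck) (hp_lt.trans_le hbottleneck)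
    obtain ⟨N, hN, htx, hrc⟩ := ((eventually_ge_atTop 1).and
      ((eventually_sum_ite_le_sum_of_lt_mean hBtx_nonneg (by linarith : 0 ≤ bbartx - ε)
        (by linarith) hBtx_mean).and
      (eventually_sum_ite_le_sum_of_lt_mean hBrc_nonneg (hqrc_maps hp) hqrc_lt
        hBrc_mean))).exists
    refine ⟨N, hN, fun k _ => ?_⟩
    simp only [apply_ite qtx, apply_ite qrc, hqtx0, hqrc0, hqtx_eq]
    exact ⟨htx k, hrc k⟩
  refine ⟨hfeasible, fun g _ ε hε => ?_⟩
  obtain ⟨N, -, hN⟩ := hfeasible ε hε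
  refine ⟨fun j => if j ≤ N then 0 else qtxinv (bbartx - ε), fun k => ?_, hN, ?_⟩
  · dsimp only
    split_ifs
    · exact le_rfl
    · exact hinv_nonneg _ (by linarith [hε.2])
  · refine (tendsto_average_Icc_one (tendsto_const_nhds.congr' ?_)).liminf_eq.ge
    filter_upwards [eventually_gt_atTop N] with j hj
    rw [if_neg (by omega)]
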